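/- Fix k ∈ (0,1], μ ∈ (0,1], δ_K ∈ (0,1) and a natural number K ≥ 1. There exist constants c₃ > 0 and c₄ > 0, depending only on δ_K, K, k and μ, with the following property. Let n > 2 and m be natural numbers, let s = ⌈k·m⌉ ≥ 1, let Φ be a random sparse Gaussian m×n matrix with support sets S_j ⊆ {1,…,m} of common size s and nonzero entries jointly independent Gaussian with mean 0 and variance 1/s, and let T ⊆ {1,…,m} be a fixed set of m' = ⌈μ·m⌉ rows such that every column support satisfies |S_j ∩ T| = ⌈μ·s⌉ ≥ 1. Consider the rescaled row-submatrix Φ' = (1/√μ)·Φ_T ∈ ℝ^{m'×n}, where Φ_T consists of the rows of Φ indexed by T. If m > c₄·ln n, then Φ' satisfies RIP(K, δ_K) with probability at least 1 − exp(−c₃·m). -/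

import Mathlib

open Matrix MeasureTheory ProbabilityTheory Real
open scoped NNReal ENNReal

/-- A matrix `Φ ∈ ℝ^{m×n}` satisfies RIP(K, δ) if
`(1−δ)‖α‖₂² ≤ ‖Φα‖₂² ≤ (1+δ)‖α‖₂²` for every vector `α` with at most `K` nonzero entries. -/
def RIP {α β : Type*} [Fintype α] [Fintype β] (Φ : Matrix α β ℝ) (K : ℕ) (δ : ℝ) : Prop :=
  ∀ v : β → ℝ, (Finset.univ.filter fun j => v j ≠ 0).card ≤ K →
    (1 - δ) * (∑ j, v j ^ 2) ≤ ∑ i, (Φ.mulVec v i) ^ 2 ∧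
      ∑ i, (Φ.mulVec v i) ^ 2 ≤ (1 + δ) * (∑ j, v j ^ 2)

lemma gauss_sq_aux (v : ℝ≥0) (hv : v ≠ 0) (a : ℝ) (ha : 2 * a * v < 1) :
    Integrable (fun x => Real.exp (a * x ^ 2)) (gaussianReal 0 v) ∧
      ∫ x, Real.exp (a * x ^ 2) ∂(gaussianReal 0 v) = 1 / Real.sqrt (1 - 2 * a * v) := by
  have hv0 : (0 : ℝ) < v := by positivity
  set b : ℝ := (1 - 2 * a * v) / (2 * v) with hb
  have hbpos : 0 < b := by
    rw [hb]
    apply div_pos <;> linarith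
  have key : ∀ x : ℝ, gaussianPDFReal 0 v x • Real.exp (a * x ^ 2) =
      (√(2 * π * v))⁻¹ * Real.exp (-b * x ^ 2) := by
    intro x
    rw [gaussianPDFReal_def, smul_eq_mul]
    simp only
    rw [mul_assoc, ← Real.exp_add]
    congr 2
    rw [hb]
    field_simp
    ring
  constructor
  · rw [gaussianReal_of_var_ne_zero _ hv,
      integrable_withDensity_iff_integrable_smul' (measurable_gaussianPDF _ _)
        (ae_of_all _ fun _ ↦ gaussianPDF_lt_top)]
    simp only [toReal_gaussianPDF, key]
    exact (integrable_exp_neg_mul_sq hbpos).const_mul _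
  · rw [integral_gaussianReal_eq_integral_smul hv]
    simp only [key]
    rw [integral_const_mul, integral_gaussian]
    have h1 : π / b = (2 * π * v) / (1 - 2 * a * v) := by
      rw [hb]
      field_simp
    rw [h1, Real.sqrt_div (by positivity)]
    have : √(2 * π * v) ≠ 0 := by positivity
    field_simp

lemma sqrt_exp_aux (u : ℝ) (h1 : -(1 / 2) ≤ u) (h2 : u ≤ 1 / 2) :
    1 / Real.sqrt (1 - u) ≤ Real.exp ((u + u ^ 2) / 2) := by
  have hpos : 0 < 1 - u := by linarith
  have main : 1 ≤ (1 - u) * Real.exp (u + u ^ 2) := by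
    rcases le_total 0 u with h | h
    · have := Real.quadratic_le_exp_of_nonneg (x := u + u ^ 2) (by positivity)
      have h3 : 1 ≤ (1 - u) * (1 + (u + u ^ 2) + (u + u ^ 2) ^ 2 / 2) := by
        have e : (1 - u) * (1 + (u + u ^ 2) + (u + u ^ 2) ^ 2 / 2) =
          1 + u ^ 2 * (1 - u - u ^ 2 - u ^ 3) / 2 := by ring
        have hu2 : u ^ 2 ≤ 1 / 4 := by nlinarith
        have hu3 : u ^ 3 ≤ 1 / 8 := by nlinarith
        have : 0 ≤ u ^ 2 * (1 - u - u ^ 2 - u ^ 3) := mul_nonneg (sq_nonneg _) (by linarith)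
        linarith
      exact h3.trans (mul_le_mul_of_nonneg_left this hpos.le)
    · have := Real.add_one_le_exp (u + u ^ 2)
      have h3 : 1 ≤ (1 - u) * (u + u ^ 2 + 1) := by
        nlinarith [mul_nonneg (neg_nonneg.2 h) (sq_nonneg u)]
      exact h3.trans (mul_le_mul_of_nonneg_left this hpos.le)
  rw [div_le_iff₀ (Real.sqrt_pos.2 hpos)]
  have e : Real.exp ((u + u ^ 2) / 2) = Real.sqrt (Real.exp (u + u ^ 2)) := Real.exp_half _
  rw [e, ← Real.sqrt_mul (Real.exp_pos _).le]
  exact Real.one_le_sqrt.2 (by linarith)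

section

variable {Ω : Type} [MeasurableSpace Ω] {P : Measure Ω} [IsProbabilityMeasure P]

lemma diag_aux (s : ℕ) (hs : 1 ≤ s) (X : Ω → ℝ) (hX : Measurable X)
    (hmap : P.map X = gaussianReal 0 ((s : ℝ≥0))⁻¹) (t : ℝ) (ht : |t| ≤ 1 / 4) :
    Integrable (fun ω => Real.exp (t * (s * (X ω * X ω) - 1))) P ∧
      mgf (fun ω => s * (X ω * X ω) - 1) P t ≤ Real.exp (2 * t ^ 2) := by
  have hs0 : (0 : ℝ) < s := by exact_mod_cast hs
  obtain ⟨ht1, ht2⟩ := abs_le.1 ht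
  have hv : ((s : ℝ≥0))⁻¹ ≠ 0 := by
    apply inv_ne_zero
    exact_mod_cast (by omega : s ≠ 0)
  have hav : 2 * (t * s) * (((s : ℝ≥0))⁻¹ : ℝ≥0) = 2 * t := by
    push_cast
    field_simp
  obtain ⟨hi, he⟩ := gauss_sq_aux _ hv (t * s) (by rw [hav]; linarith)
  rw [hav] at he
  rw [← hmap] at hi he
  rw [integral_map hX.aemeasurable (by fun_prop)] at he
  have hi' := hi.comp_measurable hX
  have e : ∀ ω, Real.exp (t * (s * (X ω * X ω) - 1)) =
      Real.exp (-t) * Real.exp (t * s * X ω ^ 2) := by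
    intro ω
    rw [← Real.exp_add]
    congr 1
    ring
  refine ⟨?_, ?_⟩
  · simp only [e]
    exact hi'.const_mul _
  · unfold mgf
    simp only [e]
    rw [integral_const_mul, he]
    calc Real.exp (-t) * (1 / √(1 - 2 * t))
        ≤ Real.exp (-t) * Real.exp ((2 * t + (2 * t) ^ 2) / 2) := by
          gcongr
          exact sqrt_exp_aux _ (by linarith) (by linarith)
      _ = Real.exp (2 * t ^ 2) := by
          rw [← Real.exp_add]
          congr 1
          ring

lemma off_aux (s : ℕ) (hs : 1 ≤ s) (X Y : Ω → ℝ) (hX : Measurable X) (hY : Measurable Y)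
    (hXm : P.map X = gaussianReal 0 ((s : ℝ≥0))⁻¹)
    (hYm : P.map Y = gaussianReal 0 ((s : ℝ≥0))⁻¹) (hind : IndepFun X Y P)
    (t : ℝ) (ht : |t| ≤ 1 / 4) :
    Integrable (fun ω => Real.exp (t * (s * (X ω * Y ω)))) P ∧
      mgf (fun ω => s * (X ω * Y ω)) P t ≤ Real.exp (2 * t ^ 2) := by
  have hs0 : (0 : ℝ) < s := by exact_mod_cast hs
  obtain ⟨ht1, ht2⟩ := abs_le.1 ht
  have ht3 : t ^ 2 ≤ 1 / 16 := by nlinarith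
  set v : ℝ≥0 := ((s : ℝ≥0))⁻¹ with hvdef
  have hv : v ≠ 0 := by
    apply inv_ne_zero
    exact_mod_cast (by omega : s ≠ 0)
  have hvr : (v : ℝ) = (s : ℝ)⁻¹ := by rw [hvdef]; push_cast; rfl
  have hprod : P.map (fun ω => (X ω, Y ω)) = (gaussianReal 0 v).prod (gaussianReal 0 v) := by
    rw [(indepFun_iff_map_prod_eq_prod_map_map hX.aemeasurable hY.aemeasurable).1 hind, hXm, hYm]
  have hav : 2 * (t ^ 2 * s / 2) * (v : ℝ) = t ^ 2 := by
    rw [hvr]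
    field_simp
  obtain ⟨hi, he⟩ := gauss_sq_aux _ hv (t ^ 2 * s / 2) (by rw [hav]; linarith)
  rw [hav] at he
  have inner : ∀ x : ℝ, ∫ y, Real.exp (t * (s * (x * y))) ∂(gaussianReal 0 v) =
      Real.exp (t ^ 2 * s / 2 * x ^ 2) := by
    intro x
    have := congrFun (mgf_fun_id_gaussianReal (μ := 0) (v := v)) (t * s * x)
    unfold mgf at this
    have e : ∀ y : ℝ, t * (s * (x * y)) = t * s * x * y := fun y => by ring
    simp only [e]
    rw [this, hvr]
    congr 1
    field_simp
    ring
  have hint : Integrable (fun z : ℝ × ℝ => Real.exp (t * (s * (z.1 * z.2))))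
      ((gaussianReal 0 v).prod (gaussianReal 0 v)) := by
    rw [integrable_prod_iff (by fun_prop)]
    constructor
    · refine ae_of_all _ fun x => ?_
      have := integrable_exp_mul_gaussianReal (μ := 0) (v := v) (t * s * x)
      refine this.congr (ae_of_all _ fun y => ?_)
      simp only
      congr 1
      ring
    · simp only [Real.norm_eq_abs, Real.abs_exp, inner]
      exact hi
  have hm : Measurable (fun ω => (X ω, Y ω)) := hX.prodMk hY
  refine ⟨?_, ?_⟩
  · rw [← hprod] at hint
    exact hint.comp_measurable hm
  · have h1 : mgf (fun ω => s * (X ω * Y ω)) P t = 1 / √(1 - t ^ 2) := by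
      unfold mgf
      rw [← he]
      have := integral_prod _ hint
      rw [← hprod, integral_map hm.aemeasurable (by fun_prop)] at this
      rw [this]
      simp only [inner]
    rw [h1]
    refine (sqrt_exp_aux _ (by nlinarith) (by linarith)).trans (Real.exp_le_exp.2 ?_)
    nlinarith [sq_nonneg t]

lemma chernoff_aux {ι : Type} [Fintype ι] (s : ℕ) (Y : ι → Ω → ℝ)
    (hcard : Fintype.card ι ≤ s)
    (hind : ∀ (a : ι) (B : Finset ι), a ∉ B → IndepFun (Y a) (∑ i ∈ B, Y i) P)
    (hY : ∀ i t, |t| ≤ 1 / 4 →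
      Integrable (fun ω => Real.exp (t * Y i ω)) P ∧ mgf (Y i) P t ≤ Real.exp (2 * t ^ 2))
    (θ : ℝ) (hθ0 : 0 ≤ θ) (hθ : θ ≤ 1) :
    P.real {ω | θ * s ≤ |∑ i, Y i ω|} ≤ 2 * Real.exp (-(θ ^ 2 / 8 * s)) := by
  classical
  have key : ∀ t, |t| ≤ 1 / 4 → ∀ B : Finset ι,
      Integrable (fun ω => Real.exp (t * (∑ i ∈ B, Y i) ω)) P ∧
      mgf (∑ i ∈ B, Y i) P t ≤ Real.exp (2 * t ^ 2 * B.card) := by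
    intro t ht B
    induction B using Finset.induction_on with
    | empty => simp
    | insert a B ha ih =>
      rw [Finset.sum_insert ha]
      obtain ⟨h1, h2⟩ := hY a t ht
      refine ⟨(hind a B ha).integrable_exp_mul_add h1 ih.1, ?_⟩
      rw [(hind a B ha).mgf_add h1.aestronglyMeasurable ih.1.aestronglyMeasurable,
        Finset.card_insert_of_notMem ha]
      refine (mul_le_mul h2 ih.2 mgf_nonneg (Real.exp_pos _).le).trans (le_of_eq ?_)
      rw [← Real.exp_add]
      congr 1
      push_cast
      ring
  have hbd : ∀ t, |t| = θ / 4 → Integrable (fun ω => Real.exp (t * (∑ i, Y i) ω)) P ∧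
      Real.exp (-(θ / 4) * (θ * s)) * mgf (∑ i, Y i) P t ≤ Real.exp (-(θ ^ 2 / 8 * s)) := by
    intro t ht
    obtain ⟨h1, h2⟩ := key t (by rw [ht]; linarith) Finset.univ
    refine ⟨h1, (mul_le_mul_of_nonneg_left h2 (Real.exp_pos _).le).trans ?_⟩
    rw [← Real.exp_add, Real.exp_le_exp]
    have hc : ((Finset.univ : Finset ι).card : ℝ) ≤ s := by
      rw [Finset.card_univ]
      exact_mod_cast hcard
    have ht2 : t ^ 2 = θ ^ 2 / 16 := by
      rw [← sq_abs, ht]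
      ring
    rw [ht2]
    nlinarith [mul_le_mul_of_nonneg_left hc (sq_nonneg θ)]
  obtain ⟨i1, b1⟩ := hbd (θ / 4) (abs_of_nonneg (by linarith))
  obtain ⟨i2, b2⟩ := hbd (-(θ / 4)) (by rw [abs_neg]; exact abs_of_nonneg (by linarith))
  have u1 := measure_ge_le_exp_mul_mgf (θ * s) (by linarith) i1
  have u2 := measure_le_le_exp_mul_mgf (-(θ * s)) (by linarith) i2
  have hsub : {ω | θ * s ≤ |∑ i, Y i ω|} ⊆
      {ω | θ * s ≤ (∑ i, Y i) ω} ∪ {ω | (∑ i, Y i) ω ≤ -(θ * s)} := by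
    intro ω hω
    simp only [Set.mem_ofPred_eq, Set.mem_union, Finset.sum_apply] at hω ⊢
    rcases le_abs.1 hω with h | h
    · exact Or.inl h
    · right; linarith
  have e : -(-(θ / 4)) * (-(θ * s)) = -(θ / 4) * (θ * s) := by ring
  rw [e] at u2
  calc P.real {ω | θ * s ≤ |∑ i, Y i ω|} ≤ _ := measureReal_mono hsub
    _ ≤ _ := measureReal_union_le _ _
    _ ≤ _ := by linarith

lemma pair_aux {m n : ℕ} (s : ℕ) (hs : 1 ≤ s) (S : Fin n → Finset (Fin m))
    (hS : ∀ j, (S j).card = s) (Φ : Ω → Matrix (Fin m) (Fin n) ℝ)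
    (hmeas : ∀ i j, Measurable fun ω => Φ ω i j)
    (hind : iIndepFun
          (fun (p : {p : Fin m × Fin n // p.1 ∈ S p.2}) ω => Φ ω p.val.1 p.val.2) P)
    (hmap : ∀ p : {p : Fin m × Fin n // p.1 ∈ S p.2},
          P.map (fun ω => Φ ω p.val.1 p.val.2) = gaussianReal 0 ((s : ℝ≥0))⁻¹)
    (hzero : ∀ ω i j, i ∉ S j → Φ ω i j = 0) (T : Finset (Fin m)) (N : ℕ)
    (hN : ∀ j, (S j ∩ T).card = N) (θ : ℝ) (hθ0 : 0 ≤ θ) (hθ : θ ≤ 1) (j l : Fin n) :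
    P.real {ω | θ * s ≤ |s * (∑ i ∈ T, Φ ω i j * Φ ω i l) - (if j = l then (N : ℝ) else 0)|}
      ≤ 2 * Real.exp (-(θ ^ 2 / 8 * s)) := by
  classical
  let A : Finset (Fin m) := (S j ∩ S l) ∩ T
  let c : ℝ := if j = l then 1 else 0
  let Y : {i // i ∈ A} → Ω → ℝ := fun i ω => s * (Φ ω i j * Φ ω i l) - c
  have hAj : ∀ i : {i // i ∈ A}, i.1 ∈ S j := fun i => by
    have := i.2
    simp only [A, Finset.mem_inter] at this
    exact this.1.1
  have hAl : ∀ i : {i // i ∈ A}, i.1 ∈ S l := fun i => by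
    have := i.2
    simp only [A, Finset.mem_inter] at this
    exact this.1.2
  have hcard : Fintype.card {i // i ∈ A} ≤ s := by
    rw [Fintype.card_coe, ← hS j]
    exact Finset.card_le_card (Finset.inter_subset_left.trans Finset.inter_subset_left)
  have hYm : ∀ i, Measurable (Y i) := fun i =>
    (((hmeas i j).mul (hmeas i l)).const_mul _).sub_const _
  have hYi : ∀ (a : {i // i ∈ A}) (B : Finset {i // i ∈ A}), a ∉ B →
      IndepFun (Y a) (∑ i ∈ B, Y i) P := by
    intro a B ha
    let F : Finset {p : Fin m × Fin n // p.1 ∈ S p.2} :=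
      Finset.univ.filter fun p => p.1.1 = a.1
    let G : Finset {p : Fin m × Fin n // p.1 ∈ S p.2} :=
      Finset.univ.filter fun p => ∃ b ∈ B, p.1.1 = b.1
    have hFG : Disjoint F G := by
      rw [Finset.disjoint_left]
      intro p hp hq
      simp only [F, G, Finset.mem_filter, Finset.mem_univ, true_and] at hp hq
      obtain ⟨b, hb, hpb⟩ := hq
      have : a = b := Subtype.ext (hp.symm.trans hpb)
      exact ha (this ▸ hb)
    have h := hind.indepFun_finset F G hFG (fun p => hmeas _ _)
    let φ : (F → ℝ) → ℝ := fun x =>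
      s * (x ⟨⟨(a.1, j), hAj a⟩, by simp [F]⟩ * x ⟨⟨(a.1, l), hAl a⟩, by simp [F]⟩) - c
    let ψ : (G → ℝ) → ℝ := fun x => ∑ b ∈ B.attach,
      (s * (x ⟨⟨(b.1.1, j), hAj b.1⟩, by
          simp only [G, Finset.mem_filter, Finset.mem_univ, true_and]; exact ⟨b.1, b.2, rfl⟩⟩ *
        x ⟨⟨(b.1.1, l), hAl b.1⟩, by
          simp only [G, Finset.mem_filter, Finset.mem_univ, true_and]; exact ⟨b.1, b.2, rfl⟩⟩) - c)
    have hφ : Measurable φ := by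
      simp only [φ]
      fun_prop
    have hψ : Measurable ψ := by
      simp only [ψ]
      fun_prop
    have h2 := h.comp hφ hψ
    have hsumB : (∑ i ∈ B, Y i) =
        ψ ∘ fun ω (p : G) => Φ ω p.1.1.1 p.1.1.2 := by
      funext ω
      rw [Finset.sum_apply, ← Finset.sum_attach]
      rfl
    rw [hsumB]
    exact h2
  have hY : ∀ i t, |t| ≤ 1 / 4 →
      Integrable (fun ω => Real.exp (t * Y i ω)) P ∧ mgf (Y i) P t ≤ Real.exp (2 * t ^ 2) := by
    intro i t ht
    by_cases hjl : j = l
    · subst hjl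
      have := diag_aux s hs _ (hmeas i j) (hmap ⟨(i.1, j), hAj i⟩) t ht
      simpa [Y, c] using this
    · have hne : (⟨(i.1, j), hAj i⟩ : {p : Fin m × Fin n // p.1 ∈ S p.2}) ≠
          ⟨(i.1, l), hAl i⟩ := by
        intro h
        exact hjl (congrArg (fun p => p.1.2) h)
      have := off_aux s hs _ _ (hmeas i j) (hmeas i l) (hmap ⟨(i.1, j), hAj i⟩)
        (hmap ⟨(i.1, l), hAl i⟩) (hind.indepFun hne) t ht
      simpa [Y, c, hjl] using this
  have main := chernoff_aux s Y hcard hYi hY θ hθ0 hθ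
  have hsum : ∀ ω, ∑ i, Y i ω =
      s * (∑ i ∈ T, Φ ω i j * Φ ω i l) - (if j = l then (N : ℝ) else 0) := by
    intro ω
    simp only [Y]
    rw [Finset.sum_sub_distrib, ← Finset.mul_sum]
    congr 1
    · congr 1
      rw [Finset.sum_coe_sort A (fun i => Φ ω i j * Φ ω i l)]
      apply Finset.sum_subset Finset.inter_subset_right
      intro i hiT hiA
      simp only [A, Finset.mem_inter, hiT, and_true, not_and_or] at hiA
      rcases hiA with h | h <;> simp [hzero ω _ _ h]
    · by_cases hjl : j = l
      · subst hjl
        simp [c, A, hN]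
      · simp [c, hjl]
  simpa only [hsum] using main

end

lemma rip_of_gram {α β : Type*} [Fintype α] [Fintype β] [DecidableEq β] (M : Matrix α β ℝ)
    (K : ℕ) (hK : 1 ≤ K) (δ : ℝ) (hδ : 0 ≤ δ)
    (h : ∀ j l, |∑ i, M i j * M i l - (if j = l then 1 else 0)| ≤ δ / K) : RIP M K δ := by
  intro v hv
  have hK0 : (0 : ℝ) < K := by exact_mod_cast hK
  have e1 : ∑ i, (M.mulVec v i) ^ 2 = ∑ j, ∑ l, v j * v l * ∑ i, M i j * M i l := by
    simp only [Matrix.mulVec, dotProduct, sq, Finset.sum_mul_sum]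
    simp only [Finset.mul_sum]
    rw [Finset.sum_comm]
    refine Finset.sum_congr rfl fun j _ => ?_
    rw [Finset.sum_comm]
    refine Finset.sum_congr rfl fun l _ => Finset.sum_congr rfl fun i _ => ?_
    ring
  have e2 : ∑ j, v j ^ 2 = ∑ j, ∑ l, v j * v l * (if j = l then 1 else 0) := by
    simp [sq]
  have e3 : |∑ i, (M.mulVec v i) ^ 2 - ∑ j, v j ^ 2| ≤ δ / K * (∑ j, |v j|) ^ 2 := by
    rw [e1, e2, ← Finset.sum_sub_distrib]
    simp only [← Finset.sum_sub_distrib, ← mul_sub]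
    rw [sq, Finset.sum_mul_sum, Finset.mul_sum]
    refine (Finset.abs_sum_le_sum_abs _ _).trans (Finset.sum_le_sum fun j _ => ?_)
    rw [Finset.mul_sum]
    refine (Finset.abs_sum_le_sum_abs _ _).trans (Finset.sum_le_sum fun l _ => ?_)
    rw [abs_mul, abs_mul, mul_comm (δ / K)]
    exact mul_le_mul_of_nonneg_left (h j l) (by positivity)
  have e4 : (∑ j, |v j|) ^ 2 ≤ K * ∑ j, v j ^ 2 := by
    have a1 : ∑ j, |v j| = ∑ j ∈ Finset.univ.filter (fun j => v j ≠ 0), |v j| := by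
      symm
      apply Finset.sum_subset (Finset.filter_subset _ _)
      intro j _ hj
      simpa using hj
    rw [a1]
    refine (sq_sum_le_card_mul_sum_sq).trans ?_
    have a2 : ∑ j ∈ Finset.univ.filter (fun j => v j ≠ 0), |v j| ^ 2 ≤ ∑ j, v j ^ 2 := by
      simp only [sq_abs]
      exact Finset.sum_le_sum_of_subset_of_nonneg (Finset.filter_subset _ _)
        fun _ _ _ => sq_nonneg _
    have a3 : ((Finset.univ.filter (fun j => v j ≠ 0)).card : ℝ) ≤ K := by exact_mod_cast hv
    exact mul_le_mul a3 a2 (Finset.sum_nonneg fun _ _ => sq_nonneg _) hK0.le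
  have e5 : δ / K * (∑ j, |v j|) ^ 2 ≤ δ * ∑ j, v j ^ 2 := by
    refine (mul_le_mul_of_nonneg_left e4 (by positivity)).trans (le_of_eq ?_)
    field_simp
  have e6 := abs_le.1 (e3.trans e5)
  constructor <;> nlinarith [e6.1, e6.2]

/-- RIP for rescaled row-submatrices of a sparse Gaussian matrix: if `Φ` is a random
`m×n` sparse Gaussian matrix with support sets `S j` of common size `s = ⌈k·m⌉` and
nonzero entries jointly independent Gaussians with mean `0` and variance `1/s`, and
`T` is a fixed set of `m' = ⌈μ·m⌉` rows with `|S j ∩ T| = ⌈μ·s⌉` for every column `j`,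
then the rescaled row-submatrix `Φ' = (1/√μ)·Φ_T` satisfies RIP(K, δ_K) with probability
at least `1 − exp(−c₃·m)` provided `m > c₄·ln n`, where the constants `c₃, c₄ > 0`
depend only on `δ_K`, `K`, `k` and `μ`. -/
theorem sparse_gaussian_submatrix_rip (k μ δK : ℝ) (hk : k ∈ Set.Ioc (0 : ℝ) 1)
    (hμ : μ ∈ Set.Ioc (0 : ℝ) 1) (hδK : δK ∈ Set.Ioo (0 : ℝ) 1) (K : ℕ) (hK : 1 ≤ K) :
    ∃ c₃ c₄ : ℝ, 0 < c₃ ∧ 0 < c₄ ∧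
      ∀ (n m : ℕ), 2 < n →
      ∀ s : ℕ, s = ⌈k * (m : ℝ)⌉₊ → 1 ≤ s →
      ∀ (Ω : Type) (_ : MeasureSpace Ω), IsProbabilityMeasure (ℙ : Measure Ω) →
      ∀ S : Fin n → Finset (Fin m), (∀ j, (S j).card = s) →
      ∀ Φ : Ω → Matrix (Fin m) (Fin n) ℝ,
        (∀ i j, Measurable fun ω => Φ ω i j) →
        iIndepFun
          (fun (p : {p : Fin m × Fin n // p.1 ∈ S p.2}) ω => Φ ω p.val.1 p.val.2) ℙ →
        (∀ p : {p : Fin m × Fin n // p.1 ∈ S p.2},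
          Measure.map (fun ω => Φ ω p.val.1 p.val.2) ℙ = gaussianReal 0 ((s : ℝ≥0))⁻¹) →
        (∀ ω i j, i ∉ S j → Φ ω i j = 0) →
      ∀ T : Finset (Fin m), T.card = ⌈μ * (m : ℝ)⌉₊ →
        (∀ j, (S j ∩ T).card = ⌈μ * (s : ℝ)⌉₊) → 1 ≤ ⌈μ * (s : ℝ)⌉₊ →
        c₄ * Real.log n < (m : ℝ) →
        ENNReal.ofReal (1 - Real.exp (-c₃ * m)) ≤
          ℙ {ω | RIP ((1 / Real.sqrt μ) •
              (Φ ω).submatrix (Subtype.val : {i // i ∈ T} → Fin m) id) K δK} := by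
  obtain ⟨hk0, hk1⟩ := hk
  obtain ⟨hμ0, hμ1⟩ := hμ
  obtain ⟨hδ0, hδ1⟩ := hδK
  have hK0 : (1 : ℝ) ≤ K := by exact_mod_cast hK
  set η : ℝ := δK / K with hη
  have hη0 : 0 < η := by positivity
  have hη1 : η ≤ 1 := by
    rw [hη, div_le_one (by linarith)]
    linarith
  set θ : ℝ := η * μ / 2 with hθ
  have hθ0 : 0 < θ := by positivity
  have hθ1 : θ ≤ 1 := by nlinarith
  set c : ℝ := θ ^ 2 / 8 * k with hc
  have hc0 : 0 < c := by positivity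
  refine ⟨c / 2, 6 / c + 1 / (θ * k), by positivity, by positivity, ?_⟩
  intro n m hn s hs hs1 Ω _ hP S hS Φ hmeas hind hmap hzero T _ hN _ hm
  set N : ℕ := ⌈μ * (s : ℝ)⌉₊ with hNdef
  have hs0 : (0 : ℝ) < s := by exact_mod_cast hs1
  have hskm : k * m ≤ s := by
    rw [hs]
    exact Nat.le_ceil _
  have hn3 : (3 : ℝ) ≤ n := by exact_mod_cast hn
  have hlog : 1 ≤ Real.log n := by
    rw [Real.le_log_iff_exp_le (by linarith)]
    have := Real.exp_one_lt_d9
    linarith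
  have hm1 : 1 / (θ * k) ≤ m := by
    have : 0 ≤ 6 / c * Real.log n := by positivity
    have : 1 / (θ * k) * 1 ≤ 1 / (θ * k) * Real.log n :=
      mul_le_mul_of_nonneg_left hlog (by positivity)
    nlinarith
  have hm2 : 6 * Real.log n ≤ c * m := by
    have : 0 ≤ 1 / (θ * k) * Real.log n := by positivity
    have h6 : 6 / c * Real.log n ≤ m := by nlinarith
    calc 6 * Real.log n = c * (6 / c * Real.log n) := by field_simp
      _ ≤ c * m := mul_le_mul_of_nonneg_left h6 hc0.le
  have hθs : 1 ≤ θ * s := by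
    rw [div_le_iff₀ (by positivity)] at hm1
    nlinarith
  have hN1 : μ * s ≤ N := Nat.le_ceil _
  have hN2 : (N : ℝ) < μ * s + 1 := Nat.ceil_lt_add_one (by positivity)
  let bad : Fin n × Fin n → Set Ω := fun q =>
    {ω | θ * s ≤ |s * (∑ i ∈ T, Φ ω i q.1 * Φ ω i q.2) - (if q.1 = q.2 then (N : ℝ) else 0)|}
  have hbad : ∀ q, (ℙ : Measure Ω).real (bad q) ≤ 2 * Real.exp (-(θ ^ 2 / 8 * s)) := fun q =>
    pair_aux s hs1 S hS Φ hmeas hind hmap hzero T N hN θ hθ0.le hθ1 q.1 q.2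
  have hbadm : ∀ q, MeasurableSet (bad q) := by
    intro q
    apply measurableSet_le measurable_const
    have : Measurable fun ω => ∑ i ∈ T, Φ ω i q.1 * Φ ω i q.2 :=
      Finset.measurable_fun_sum _ fun i _ => (hmeas i _).mul (hmeas i _)
    exact continuous_abs.measurable.comp ((this.const_mul _).sub_const _)
  have hU : (ℙ : Measure Ω).real (⋃ q, bad q) ≤ Real.exp (-(c / 2) * m) := by
    calc (ℙ : Measure Ω).real (⋃ q, bad q) ≤ ∑ q, (ℙ : Measure Ω).real (bad q) :=
          measureReal_iUnion_fintype_le _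
      _ ≤ ∑ q : Fin n × Fin n, 2 * Real.exp (-(θ ^ 2 / 8 * s)) :=
          Finset.sum_le_sum fun q _ => hbad q
      _ = n * n * (2 * Real.exp (-(θ ^ 2 / 8 * s))) := by simp
      _ ≤ n * n * (n * Real.exp (-(c * m))) := by
          have : c * m ≤ θ ^ 2 / 8 * s := by
            rw [hc, mul_assoc]
            exact mul_le_mul_of_nonneg_left hskm (by positivity)
          gcongr
          linarith
      _ = Real.exp (3 * Real.log n - c * m) := by
          have h3 : Real.exp (3 * Real.log n) = (n : ℝ) ^ 3 := by
            rw [mul_comm, Real.exp_mul, Real.exp_log (by linarith)]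
            norm_cast
          rw [sub_eq_add_neg, Real.exp_add, h3]
          ring
      _ ≤ Real.exp (-(c / 2) * m) := by
          apply Real.exp_le_exp.2
          linarith
  have hsub : (⋃ q, bad q)ᶜ ⊆ {ω | RIP ((1 / Real.sqrt μ) •
      (Φ ω).submatrix (Subtype.val : {i // i ∈ T} → Fin m) id) K δK} := by
    intro ω hω
    simp only [Set.mem_compl_iff, Set.mem_iUnion, not_exists] at hω
    refine rip_of_gram _ K hK δK hδ0.le fun j l => ?_
    have hjl : |s * (∑ i ∈ T, Φ ω i j * Φ ω i l) - (if j = l then (N : ℝ) else 0)| < θ * s :=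
      lt_of_not_ge (hω (j, l))
    have e : ∑ i, ((1 / Real.sqrt μ) •
        (Φ ω).submatrix (Subtype.val : {i // i ∈ T} → Fin m) id) i j * ((1 / Real.sqrt μ) •
        (Φ ω).submatrix (Subtype.val : {i // i ∈ T} → Fin m) id) i l =
        1 / μ * ∑ i ∈ T, Φ ω i j * Φ ω i l := by
      rw [← Finset.sum_coe_sort T (fun i => Φ ω i j * Φ ω i l), Finset.mul_sum]
      refine Finset.sum_congr rfl fun i _ => ?_
      simp only [Matrix.smul_apply, Matrix.submatrix_apply, id, smul_eq_mul]
      have : (1 / μ) = 1 / Real.sqrt μ * (1 / Real.sqrt μ) := by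
        rw [div_mul_div_comm, Real.mul_self_sqrt hμ0.le, one_mul]
      rw [this]
      ring
    rw [e]
    set g := ∑ i ∈ T, Φ ω i j * Φ ω i l
    have hfin : |s * g - (if j = l then μ * s else 0)| ≤ η * (μ * s) := by
      have h2 : η * (μ * s) = θ * s + θ * s := by rw [hθ]; ring
      rw [abs_lt] at hjl
      rw [abs_le, h2]
      split_ifs at hjl ⊢ <;> constructor <;> linarith [hjl.1, hjl.2]
    have e2 : 1 / μ * g - (if j = l then 1 else 0) =
        (s * g - (if j = l then μ * s else 0)) / (μ * s) := by
      split_ifs <;> field_simp <;> ring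
    rw [e2, abs_div, abs_of_pos (by positivity : 0 < μ * s), div_le_iff₀ (by positivity)]
    exact hfin
  refine le_trans ?_ (measure_mono hsub)
  rw [← ofReal_measureReal, probReal_compl_eq_one_sub (MeasurableSet.iUnion hbadm)]
  apply ENNReal.ofReal_le_ofReal
  linarith
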